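/- Let c > 0 and let χ : [0,1] × ℝ → ℝ² be continuously differentiable and satisfy the transport equation ∂_t χ(x,t) = c ∂_x χ(x,t) for all x ∈ [0,1] and t ∈ ℝ. For k ∈ ℕ define 𝔛_k(t) = ∫₀¹ χ(x,t) ℒ_k(x) dx ∈ ℝ². Then for every k ∈ ℕ and every t, 𝔛_k is differentiable and d/dt 𝔛_k(t) = c (χ(1,t) − (−1)^k χ(0,t)) − c Σ_{j=0}^{k−1} ℓ_{k,j} 𝔛_j(t), where ℓ_{k,j} = (2j+1)(1 − (−1)^{j+k}). -/

import Mathlib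

open Set

/-- The shifted Legendre polynomial on `[0,1]`:
`ℒ_k(x) = (−1)^k Σ_{l=0}^{k} (−1)^l (k choose l) ((k+l) choose l) x^l`. -/
noncomputable def shiftedLegendre (k : ℕ) (x : ℝ) : ℝ :=
  (-1 : ℝ)^k * ∑ l ∈ Finset.range (k+1),
    (-1 : ℝ)^l * (k.choose l : ℝ) * ((k+l).choose l : ℝ) * x^l

/-- Adjacent odd and even binomial coefficients satisfy the three-term identity behind the
recurrence for derivatives of Legendre polynomials. -/
lemma choose_two_step_identity (k l : ℕ) :
    ((2 * l + 1 : ℕ) : ℝ) * (((k + l + 3).choose (2 * l + 2) : ℝ)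
        - ((k + l + 1).choose (2 * l + 2) : ℝ))
      = (2 * k + 3) * ((k + l + 1).choose (2 * l) : ℝ) := by
  have h₁ : (k + l + 3).choose (2 * l + 2) = (k + l + 1).choose (2 * l)
      + 2 * (k + l + 1).choose (2 * l + 1) + (k + l + 1).choose (2 * l + 2) := by
    simp only [Nat.choose_succ_succ' (k + l + 2), Nat.choose_succ_succ' (k + l + 1)]
    ring
  have h₂ : ((k + l + 1).choose (2 * l + 1) : ℝ) * (2 * l + 1)
      = ((k + l + 1).choose (2 * l) : ℝ) * (k + 1 - l) := by
    rcases le_or_gt (2 * l) (k + l + 1) with h | h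
    · have := congrArg (Nat.cast (R := ℝ)) (Nat.choose_succ_right_eq (k + l + 1) (2 * l))
      push_cast [Nat.cast_sub h] at this
      linear_combination this
    · simp [Nat.choose_eq_zero_of_lt h, Nat.choose_eq_zero_of_lt (h.trans (Nat.lt_succ_self _))]
  rw [h₁]
  push_cast
  linear_combination 2 * h₂

/-- The `l`-th coefficient of `shiftedLegendre k`. -/
noncomputable def shiftedLegendreCoeff (k l : ℕ) : ℝ :=
  (-1) ^ (k + l) * (l.centralBinom * (k + l).choose (2 * l))

lemma shiftedLegendreCoeff_eq_zero {k l : ℕ} (h : k < l) : shiftedLegendreCoeff k l = 0 := by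
  simp [shiftedLegendreCoeff, Nat.choose_eq_zero_of_lt (show k + l < 2 * l by omega)]

lemma shiftedLegendreCoeff_succ_recurrence (k l : ℕ) :
    (l + 1) * (shiftedLegendreCoeff (k + 2) (l + 1) - shiftedLegendreCoeff k (l + 1))
      = 2 * (2 * k + 3) * shiftedLegendreCoeff (k + 1) l := by
  have h₁ := congrArg (Nat.cast (R := ℝ)) (Nat.succ_mul_centralBinom_succ l)
  have h₂ := choose_two_step_identity k l
  push_cast at h₁ h₂
  simp only [shiftedLegendreCoeff, show k + 2 + (l + 1) = k + l + 3 by ring,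
    show k + (l + 1) = k + l + 1 by ring, show k + 1 + l = k + l + 1 by ring,
    show 2 * (l + 1) = 2 * l + 2 by ring, pow_succ]
  linear_combination (-1) * (-1) ^ (k + l) * (((k + l + 3).choose (2 * l + 2) : ℝ)
        - ((k + l + 1).choose (2 * l + 2) : ℝ)) * h₁
    - 2 * (-1) ^ (k + l) * (l.centralBinom : ℝ) * h₂

lemma shiftedLegendre_eq_sum {k N : ℕ} (hN : k + 1 ≤ N) (x : ℝ) :
    shiftedLegendre k x = ∑ l ∈ Finset.range N, shiftedLegendreCoeff k l * x ^ l := by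
  rw [← Finset.sum_subset (Finset.range_mono hN), shiftedLegendre, Finset.mul_sum]
  · refine Finset.sum_congr rfl fun l _ => ?_
    have h : (k + l).choose (2 * l) * l.centralBinom = (k + l).choose l * k.choose l := by
      rw [Nat.centralBinom, Nat.choose_mul (by omega)]
      congr 2 <;> omega
    have h' := congrArg (Nat.cast (R := ℝ)) h
    push_cast at h'
    rw [shiftedLegendreCoeff, pow_add]
    linear_combination (-1) * (-1) ^ k * (-1) ^ l * x ^ l * h'
  · intro l _ hl
    rw [shiftedLegendreCoeff_eq_zero (by simpa using hl), zero_mul]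

lemma hasDerivAt_sum_mul_pow (a : ℕ → ℝ) (N : ℕ) (x : ℝ) :
    HasDerivAt (fun y => ∑ l ∈ Finset.range (N + 1), a l * y ^ l)
      (∑ l ∈ Finset.range N, (l + 1) * a (l + 1) * x ^ l) x := by
  have h := HasDerivAt.fun_sum (u := Finset.range (N + 1)) (x := x) fun l _ =>
    (hasDerivAt_pow l x).const_mul (a l)
  refine h.congr_deriv ?_
  rw [Finset.sum_range_succ']
  simp only [Nat.cast_zero, zero_mul, mul_zero, add_zero]
  refine Finset.sum_congr rfl fun l _ => ?_
  push_cast [Nat.add_sub_cancel]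
  ring

lemma hasDerivAt_shiftedLegendre_sub (k : ℕ) (x : ℝ) :
    HasDerivAt (fun y => shiftedLegendre (k + 2) y - shiftedLegendre k y)
      (2 * (2 * k + 3) * shiftedLegendre (k + 1) x) x := by
  have h := hasDerivAt_sum_mul_pow
    (fun l => shiftedLegendreCoeff (k + 2) l - shiftedLegendreCoeff k l) (k + 2) x
  simp only [shiftedLegendreCoeff_succ_recurrence, sub_mul, Finset.sum_sub_distrib, mul_assoc,
    ← Finset.mul_sum] at h
  simpa only [shiftedLegendre_eq_sum (show k + 2 + 1 ≤ k + 2 + 1 from le_rfl),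
    shiftedLegendre_eq_sum (show k + 1 ≤ k + 2 + 1 by omega),
    shiftedLegendre_eq_sum (show k + 1 + 1 ≤ k + 2 from le_rfl), mul_assoc] using h

lemma hasDerivAt_shiftedLegendre (k : ℕ) (x : ℝ) :
    HasDerivAt (shiftedLegendre k)
      (∑ j ∈ Finset.range k,
        ((2 * (j : ℝ) + 1) * (1 - (-1 : ℝ) ^ (j + k))) * shiftedLegendre j x) x := by
  induction k using Nat.twoStepInduction with
  | zero =>
    refine (hasDerivAt_const x (1 : ℝ)).congr_of_eventuallyEq (.of_forall fun y => ?_)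
      |>.congr_deriv (by simp)
    simp [shiftedLegendre]
  | one =>
    have h : shiftedLegendre 1 = fun y => 2 * y - 1 := by
      ext y
      simp [shiftedLegendre, Finset.sum_range_succ]
      ring
    rw [h]
    refine (((hasDerivAt_id x).const_mul 2).sub_const 1).congr_deriv ?_
    norm_num [shiftedLegendre]
  | more k ih _ =>
    have h := (hasDerivAt_shiftedLegendre_sub k x).fun_add ih
    simp only [sub_add_cancel] at h
    refine h.congr_deriv ?_
    have e : (-1 : ℝ) ^ (k + (k + 2)) = 1 := Even.neg_one_pow ⟨k + 1, by ring⟩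
    have o : (-1 : ℝ) ^ (k + 1 + (k + 2)) = -1 := Odd.neg_one_pow ⟨k + 1, by ring⟩
    rw [Finset.sum_range_succ, Finset.sum_range_succ, e, o]
    push_cast
    ring_nf

lemma shiftedLegendre_zero_right (k : ℕ) : shiftedLegendre k 0 = (-1) ^ k := by
  simp [shiftedLegendre, Finset.sum_range_succ']

lemma shiftedLegendre_eq_aeval (k : ℕ) (x : ℝ) :
    shiftedLegendre k x = (-1) ^ k * Polynomial.aeval x (Polynomial.shiftedLegendre k) := by
  simp only [shiftedLegendre, Polynomial.shiftedLegendre, map_sum, map_mul, map_pow,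
    Polynomial.aeval_X, Polynomial.aeval_C]
  congr 1
  refine Finset.sum_congr rfl fun l _ => ?_
  simp [Nat.choose_symm_add (a := k) (b := l)]

lemma shiftedLegendre_one_right (k : ℕ) : shiftedLegendre k 1 = 1 := by
  have h := shiftedLegendre_zero_right k
  rw [shiftedLegendre_eq_aeval] at h ⊢
  rw [Polynomial.shiftedLegendre_eval_symm, sub_self, h, ← mul_pow]
  norm_num

lemma continuous_shiftedLegendre (k : ℕ) : Continuous (shiftedLegendre k) :=
  continuous_iff_continuousAt.2 fun x => (hasDerivAt_shiftedLegendre k x).continuousAt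

/-- Integration by parts against `shiftedLegendre k`. -/
lemma integral_deriv_mul_shiftedLegendre {u u' : ℝ → ℝ}
    (hu : ∀ x ∈ Icc (0 : ℝ) 1, HasDerivWithinAt u (u' x) (Icc (0 : ℝ) 1) x)
    (hu' : ContinuousOn u' (Icc (0 : ℝ) 1)) (k : ℕ) :
    ∫ x in (0 : ℝ)..1, u' x * shiftedLegendre k x
      = u 1 - (-1) ^ k * u 0
        - ∑ j ∈ Finset.range k, ((2 * (j : ℝ) + 1) * (1 - (-1 : ℝ) ^ (j + k)))
            * ∫ x in (0 : ℝ)..1, u x * shiftedLegendre j x := by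
  have hI : uIcc (0 : ℝ) 1 = Icc 0 1 := uIcc_of_le zero_le_one
  have huc : ContinuousOn u (uIcc 0 1) := hI ▸ fun x hx => (hu x hx).continuousWithinAt
  have hint (j : ℕ) : IntervalIntegrable (fun x => u x * shiftedLegendre j x)
      MeasureTheory.volume 0 1 :=
    (huc.mul (continuous_shiftedLegendre j).continuousOn).intervalIntegrable
  have h := intervalIntegral.integral_mul_deriv_eq_deriv_mul_of_hasDerivWithinAt
    (a := 0) (b := 1) (fun x _ => (hasDerivAt_shiftedLegendre k x).hasDerivWithinAt)
    (by rwa [hI])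
    (Continuous.intervalIntegrable (continuous_finsetSum _ fun j _ =>
      (continuous_shiftedLegendre j).const_mul _) 0 1)
    (hI ▸ hu' : ContinuousOn u' (uIcc 0 1)).intervalIntegrable
  simp only [mul_comm (u' _)]
  rw [h, shiftedLegendre_one_right, shiftedLegendre_zero_right, one_mul]
  congr 1
  simp only [← intervalIntegral.integral_const_mul]
  rw [← intervalIntegral.integral_finsetSum fun j _ => (hint j).const_mul _]
  refine intervalIntegral.integral_congr fun x _ => ?_
  simp only [Finset.sum_mul]
  exact Finset.sum_congr rfl fun j _ => by ring

/-- Differentiation under the integral sign over a compact interval, for a `C¹` integrand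
multiplied by a continuous weight. -/
lemma hasDerivAt_integral_mul_of_continuousOn {f f' : ℝ → ℝ → ℝ} {w : ℝ → ℝ} {a b : ℝ}
    (hf : ContinuousOn (fun p : ℝ × ℝ => f p.1 p.2) (uIcc a b ×ˢ univ))
    (hf' : ContinuousOn (fun p : ℝ × ℝ => f' p.1 p.2) (uIcc a b ×ˢ univ))
    (hderiv : ∀ x ∈ uIcc a b, ∀ t, HasDerivAt (f x) (f' x t) t)
    (hw : Continuous w) (t : ℝ) :
    HasDerivAt (fun s => ∫ x in a..b, f x s * w x) (∫ x in a..b, f' x t * w x) t := by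
  have slice {g : ℝ → ℝ → ℝ}
      (hg : ContinuousOn (fun p : ℝ × ℝ => g p.1 p.2) (uIcc a b ×ˢ univ)) (s : ℝ) :
      IntervalIntegrable (fun x => g x s * w x) MeasureTheory.volume a b := by
    refine ContinuousOn.intervalIntegrable (ContinuousOn.mul ?_ hw.continuousOn)
    exact hg.comp (f := fun x => (x, s)) (by fun_prop) fun x hx => ⟨hx, mem_univ _⟩
  have hK := (isCompact_uIcc (a := a) (b := b)).prod (isCompact_Icc (a := t - 1) (b := t + 1))
  obtain ⟨C, hC⟩ := hK.exists_bound_of_continuousOn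
    ((hf'.mono (prod_mono_right (subset_univ _))).mul
      (hw.comp continuous_fst).continuousOn)
  refine (intervalIntegral.hasDerivAt_integral_of_dominated_loc_of_deriv_le
    (F := fun s x => f x s * w x) (F' := fun s x => f' x s * w x) (bound := fun _ => C)
    (Icc_mem_nhds (sub_one_lt t) (lt_add_one t))
    (.of_forall fun s => (slice hf s).def'.aestronglyMeasurable) (slice hf t)
    (slice hf' t).def'.aestronglyMeasurable
    (.of_forall fun x hx s hs => hC (x, s) ⟨uIoc_subset_uIcc hx, hs⟩)
    intervalIntegrable_const
    (.of_forall fun x hx s _ => (hderiv x (uIoc_subset_uIcc hx) s).mul_const (w x))).2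

/-- **Lemma 3.** If `χ : [0,1]×ℝ → ℝ²` is `C¹` and satisfies the transport
equation `∂_t χ = c ∂_x χ`, then the projections `𝔛_k(t) = ∫₀¹ χ(x,t) ℒ_k(x) dx`
satisfy `d𝔛_k/dt = c(χ(1,t) − (−1)^k χ(0,t)) − c Σ_{j<k} ℓ_{k,j} 𝔛_j(t)` with
`ℓ_{k,j} = (2j+1)(1 − (−1)^{j+k})`. -/
theorem legendre_projection_derivative
    (c : ℝ) (hc : 0 < c)
    (χ χx χt : ℝ → ℝ → Fin 2 → ℝ)
    (hχx : ∀ t : ℝ, ∀ x ∈ Icc (0:ℝ) 1,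
      HasDerivWithinAt (fun y => χ y t) (χx x t) (Icc (0:ℝ) 1) x)
    (hχt : ∀ x ∈ Icc (0:ℝ) 1, ∀ t : ℝ, HasDerivAt (fun s => χ x s) (χt x t) t)
    (hcχ : ContinuousOn (fun p : ℝ × ℝ => χ p.1 p.2) (Icc (0:ℝ) 1 ×ˢ univ))
    (hcχx : ContinuousOn (fun p : ℝ × ℝ => χx p.1 p.2) (Icc (0:ℝ) 1 ×ˢ univ))
    (hcχt : ContinuousOn (fun p : ℝ × ℝ => χt p.1 p.2) (Icc (0:ℝ) 1 ×ˢ univ))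
    (htransport : ∀ x ∈ Icc (0:ℝ) 1, ∀ t : ℝ, χt x t = c • χx x t) :
    ∀ (k : ℕ) (t : ℝ),
      HasDerivAt (fun s => (fun i => ∫ x in (0:ℝ)..1, χ x s i * shiftedLegendre k x))
        (c • (χ 1 t - (-1 : ℝ)^k • χ 0 t)
          - c • ∑ j ∈ Finset.range k,
              ((2 * (j:ℝ) + 1) * (1 - (-1:ℝ)^(j+k))) •
                (fun i => ∫ x in (0:ℝ)..1, χ x t i * shiftedLegendre j x)) t := by
  intro k t
  have hI : uIcc (0 : ℝ) 1 = Icc 0 1 := uIcc_of_le zero_le_one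
  refine hasDerivAt_pi.2 fun i => ?_
  have hpar := hasDerivAt_integral_mul_of_continuousOn (a := 0) (b := 1)
    (f := fun x s => χ x s i) (f' := fun x s => χt x s i) (w := shiftedLegendre k)
    (by rw [hI]; exact continuousOn_pi.1 hcχ i) (by rw [hI]; exact continuousOn_pi.1 hcχt i)
    (by rw [hI]; exact fun x hx s => hasDerivAt_pi.1 (hχt x hx s) i)
    (continuous_shiftedLegendre k) t
  have hparts := integral_deriv_mul_shiftedLegendre
    (u := fun x => χ x t i) (u' := fun x => χx x t i)
    (fun x hx => hasDerivWithinAt_pi.1 (hχx t x hx) i)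
    ((continuousOn_pi.1 hcχx i).comp (f := fun x => (x, t)) (by fun_prop)
      fun x hx => ⟨hx, mem_univ _⟩) k
  refine hpar.congr_deriv ?_
  calc ∫ x in (0 : ℝ)..1, χt x t i * shiftedLegendre k x
      = ∫ x in (0 : ℝ)..1, c * (χx x t i * shiftedLegendre k x) := by
        refine intervalIntegral.integral_congr fun x hx => ?_
        simp [htransport x (hI ▸ hx) t, mul_assoc]
    _ = _ := by
        rw [intervalIntegral.integral_const_mul, hparts]
        simp [Finset.sum_apply, mul_sub]
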